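/- For every prime number p, the one-variable polynomial J_p(X,X) satisfies J_p(X,X) ≡ −(X^p − X)² mod p; in particular J_p(X,X) is not the zero polynomial. -/

import Mathlib

open Polynomial Complex IntermediateField

noncomputable section

/-- 2×2 integer matrices. -/
abbrev Mat : Type := Matrix (Fin 2) (Fin 2) ℤ

/-- The modular group SL₂(ℤ). -/
abbrev SL2Z := Matrix.SpecialLinearGroup (Fin 2) ℤ

/-- A 2×2 integer matrix is primitive if the gcd of its four entries is 1. -/
def Mat.IsPrimitive (S : Mat) : Prop :=
  Nat.gcd (Nat.gcd (S 0 0).natAbs (S 0 1).natAbs)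
    (Nat.gcd (S 1 0).natAbs (S 1 1).natAbs) = 1

/-- Left equivalence of matrices under SL₂(ℤ). -/
def LeftEquiv (S T : Mat) : Prop := ∃ M : SL2Z, S = (M : Mat) * T

/-- Möbius action of an integer matrix on a complex number. -/
def moeb (S : Mat) (z : ℂ) : ℂ :=
  ((S 0 0 : ℂ) * z + (S 0 1 : ℂ)) / ((S 1 0 : ℂ) * z + (S 1 1 : ℂ))

/-- ψ(s) = s·∏_{p∣s}(1+1/p) = Σ_{d∣s squarefree} s/d. -/
def psi (s : ℕ) : ℕ := ∑ d ∈ s.divisors, if Squarefree d then s / d else 0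

/-- Eisenstein series g₂. -/
def g2C (z : ℂ) : ℂ :=
  60 * ∑' w : {v : ℤ × ℤ // v ≠ 0}, ((w.1.1 : ℂ) * z + (w.1.2 : ℂ)) ^ (-4 : ℤ)

/-- Eisenstein series g₃. -/
def g3C (z : ℂ) : ℂ :=
  140 * ∑' w : {v : ℤ × ℤ // v ≠ 0}, ((w.1.1 : ℂ) * z + (w.1.2 : ℂ)) ^ (-6 : ℤ)

/-- The discriminant Δ. -/
def discC (z : ℂ) : ℂ := g2C z ^ 3 - 27 * g3C z ^ 2

/-- The modular invariant j. -/
def jC (z : ℂ) : ℂ := 1728 * g2C z ^ 3 / discC z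

/-- A family of matrices is a complete system of representatives of the left SL₂(ℤ)-orbits
of primitive integer matrices of determinant `s`. -/
def IsOrbitReps (s : ℕ) {n : ℕ} (R : Fin n → Mat) : Prop :=
  (∀ ν, (R ν).IsPrimitive ∧ (R ν).det = (s : ℤ)) ∧
  ∀ T : Mat, T.IsPrimitive → T.det = (s : ℤ) → ∃! ν, LeftEquiv T (R ν)

/-- Evaluation of an integer polynomial at j(z). -/
def evalAtJ (z : ℂ) : Polynomial ℤ →+* ℂ := eval₂RingHom (Int.castRingHom ℂ) (jC z)

/-- J is the modular polynomial of level s: an element of ℤ[Y][X], monic in X of degree ψ(s),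
such that J(X, j(ω)) = ∏_ν (X − j(S_ν ω)) for every ω in the upper half-plane. -/
def IsModularPoly (s : ℕ) (J : Polynomial (Polynomial ℤ)) : Prop :=
  J.Monic ∧ J.natDegree = psi s ∧
  ∀ R : Fin (psi s) → Mat, IsOrbitReps s R → ∀ z : ℂ, 0 < z.im →
    J.map (evalAtJ z) = ∏ ν, (X - C (jC (moeb (R ν) z)))

/-- The one-variable polynomial J(X,X) obtained by setting Y = X. -/
def diagPoly (J : Polynomial (Polynomial ℤ)) : Polynomial ℤ := J.eval Polynomial.X

/-- φ_S(ω) = s¹²·Δ(Sω)/((cω+d)¹²·Δ(ω)). -/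
def phiS (S : Mat) (z : ℂ) : ℂ :=
  (S.det : ℂ) ^ 12 * discC (moeb S z) /
    (((S 1 0 : ℂ) * z + (S 1 1 : ℂ)) ^ 12 * discC z)

/-- K is an imaginary quadratic subfield of ℂ. -/
def IsImagQuad (K : Subfield ℂ) : Prop :=
  ∃ θ : ℂ, 0 < θ.im ∧ Module.finrank ℚ ℚ⟮θ⟯ = 2 ∧ K = ℚ⟮θ⟯.toSubfield

/-- O is an order of the field K: a subring of K which is a finitely generated additive
group containing a ℚ-basis of K. -/
structure IsOrder (K : Subfield ℂ) (O : Subring ℂ) : Prop where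
  le : (O : Set ℂ) ⊆ (K : Set ℂ)
  fg : O.toAddSubgroup.FG
  full : ∀ x ∈ K, ∃ n : ℤ, n ≠ 0 ∧ (n : ℂ) * x ∈ O

/-- The lattice spanned by a and b. -/
def zLat (a b : ℂ) : AddSubgroup ℂ := AddSubgroup.closure {a, b}

/-- (a,b) is a ℤ-basis (with Im(a/b) > 0) of a proper (characteristic) ideal of the
order O of K: the lattice ℤa+ℤb lies in K and its multiplier ring is exactly O. -/
def IsIdealBasis (K : Subfield ℂ) (O : Subring ℂ) (a b : ℂ) : Prop :=
  0 < (a / b).im ∧ a ∈ K ∧ b ∈ K ∧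
  ∀ lam : ℂ, lam ∈ O ↔ (lam * a ∈ zLat a b ∧ lam * b ∈ zLat a b)

/-- Two lattices differ by a nonzero scalar factor. -/
def LatEquiv (A B : AddSubgroup ℂ) : Prop :=
  ∃ μ : ℂ, μ ≠ 0 ∧ (B : Set ℂ) = (fun z => μ * z) '' (A : Set ℂ)

/-- The two ideals with the given bases lie in the same ideal class. -/
def IdealEquiv (a b a' b' : ℂ) : Prop := LatEquiv (zLat a b) (zLat a' b')

/-- Product of two lattices. -/
def latMul (A B : AddSubgroup ℂ) : AddSubgroup ℂ :=
  AddSubgroup.closure {z : ℂ | ∃ x ∈ A, ∃ y ∈ B, z = x * y}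

/-- μ is a primitive element of the order O : μ ∈ O and μ/t ∉ O for every integer t > 1. -/
def IsPrimElem (O : Subring ℂ) (μ : ℂ) : Prop :=
  μ ∈ O ∧ ∀ t : ℤ, 1 < t → μ / (t : ℂ) ∉ O

/-- μ and μ' are associated in O (differ by a unit of O). -/
def UnitAssoc (O : Subring ℂ) (μ μ' : ℂ) : Prop :=
  ∃ ε : ℂ, ε ∈ O ∧ ε ≠ 0 ∧ ε⁻¹ ∈ O ∧ μ' = ε * μ

/-- The ring of integers of a subfield K of ℂ, as a subring of ℂ. -/
def OK (K : Subfield ℂ) : Subring ℂ := (integralClosure ℤ ℂ).toSubring ⊓ K.toSubring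

/-- The index of an order O in the maximal order of K (for a quadratic field this
equals the conductor f of O). -/
def condIndex (K : Subfield ℂ) (O : Subring ℂ) : ℕ :=
  (O.toAddSubgroup.addSubgroupOf (OK K).toAddSubgroup).index

/-- The lattice in ℂ attached to an ideal of the maximal order of K. -/
def idealLat (K : Subfield ℂ) (I : Ideal ↥(OK K)) : AddSubgroup ℂ :=
  AddSubgroup.closure {z : ℂ | ∃ x ∈ I, (x : ℂ) = z}

/-- The lattice attached to the O-ideal I ∩ O, for an ideal I of the maximal order. -/
def primeOrderLat (K : Subfield ℂ) (O : Subring ℂ) (I : Ideal ↥(OK K)) : AddSubgroup ℂ :=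
  AddSubgroup.closure {z : ℂ | z ∈ O ∧ ∃ x ∈ I, (x : ℂ) = z}

/-- The set of all class invariants j(k) of ideal classes of the order O. -/
def classInvSet (K : Subfield ℂ) (O : Subring ℂ) : Set ℂ :=
  {w : ℂ | ∃ a b : ℂ, IsIdealBasis K O a b ∧ w = jC (a / b)}

/-- The ring class field Ω_R : the subfield of ℂ generated by K together with all
class invariants of the order O. -/
def ringClassField (K : Subfield ℂ) (O : Subring ℂ) : Subfield ℂ :=
  Subfield.closure ((K : Set ℂ) ∪ classInvSet K O)

theorem le_ringClassField (K : Subfield ℂ) (O : Subring ℂ) : K ≤ ringClassField K O :=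
  fun _ hx => Subfield.subset_closure (Set.mem_union_left _ hx)

noncomputable instance rcfAlgebra (K : Subfield ℂ) (O : Subring ℂ) :
    Algebra ↥K ↥(ringClassField K O) :=
  (Subfield.inclusion (le_ringClassField K O)).toAlgebra

theorem OK_mono {K L : Subfield ℂ} (h : K ≤ L) : OK K ≤ OK L := by
  intro x hx
  rw [OK, Subring.mem_inf] at hx ⊢
  exact ⟨hx.1, h hx.2⟩

/-- 𝔭 splits completely in L/K: the extension of 𝔭 to the ring of integers of L is a
product of pairwise distinct primes, each of residue degree one over 𝔭. -/
def SplitsCompletely (K L : Subfield ℂ) (h : K ≤ L) (p : Ideal ↥(OK K)) : Prop :=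
  ∃ (g : ℕ) (Q : Fin g → Ideal ↥(OK L)),
    Function.Injective Q ∧ (∀ i, (Q i).IsPrime) ∧
    Ideal.map (Subring.inclusion (OK_mono h)) p = ∏ i, Q i ∧
    ∀ i, Nat.card (↥(OK L) ⧸ Q i) = Nat.card (↥(OK K) ⧸ p)

/-- L is a finite extension of ℚ (a number field) inside ℂ. -/
def FinDimOverQ (L : Subfield ℂ) : Prop :=
  ∃ t : Finset ℂ, (L : Set ℂ) ⊆ (Submodule.span ℚ (t : Set ℂ) : Submodule ℚ ℂ)

/-- Lattice Eisenstein sums Σ_{w∈L, w≠0} w^{-k}. -/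
def gkL (k : ℕ) (L : AddSubgroup ℂ) : ℂ :=
  ∑' w : {w : ℂ // w ∈ L ∧ w ≠ 0}, (w : ℂ) ^ (-(k : ℤ))

def g2L (L : AddSubgroup ℂ) : ℂ := 60 * gkL 4 L
def g3L (L : AddSubgroup ℂ) : ℂ := 140 * gkL 6 L
def discL (L : AddSubgroup ℂ) : ℂ := g2L L ^ 3 - 27 * g3L L ^ 2

/-- The Weierstrass ℘-function of a lattice. -/
def wpL (z : ℂ) (L : AddSubgroup ℂ) : ℂ :=
  z ^ (-2 : ℤ) + ∑' w : {w : ℂ // w ∈ L ∧ w ≠ 0},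
    ((z - (w : ℂ)) ^ (-2 : ℤ) - (w : ℂ) ^ (-2 : ℤ))

/-- The Weber function τ_R(z, 𝔴), where e is the number of units of R. -/
def weber (e : ℕ) (z : ℂ) (L : AddSubgroup ℂ) : ℂ :=
  if e = 4 then 2 ^ 8 * 3 ^ 4 * (g2L L ^ 2 / discL L) * wpL z L ^ 2
  else if e = 6 then -(2 ^ 9 * 3 ^ 6) * (g3L L / discL L) * wpL z L ^ 3
  else -(2 ^ 7 * 3 ^ 5) * (g2L L * g3L L / discL L) * wpL z L

/-- The number of units (roots of unity) in the ring of integers of K. -/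
def numRootsOfUnity (K : Subfield ℂ) : ℕ :=
  Nat.card {x : ℂ // x ∈ OK K ∧ ∃ n : ℕ, 0 < n ∧ x ^ n = 1}

/-- λ ≡ 1 mod* 𝔪 (multiplicative congruence): λ = β/γ with β, γ integral and prime
to 𝔪 and β ≡ γ mod 𝔪. -/
def MulCongOne (K : Subfield ℂ) (m : Ideal ↥(OK K)) (lam : ℂ) : Prop :=
  ∃ β γ : ↥(OK K), (γ : ℂ) ≠ 0 ∧ lam = (β : ℂ) / (γ : ℂ) ∧
    Ideal.span {β} ⊔ m = ⊤ ∧ Ideal.span {γ} ⊔ m = ⊤ ∧ β - γ ∈ m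

/-- The Dedekind eta function. -/
def dedekindEta (z : ℂ) : ℂ :=
  Complex.exp (Real.pi * Complex.I * z / 12) *
    ∏' n : ℕ, (1 - Complex.exp (2 * Real.pi * Complex.I * ((n : ℂ) + 1) * z))

/-- ζ₂₄ = e^{2πi/24}. -/
def zeta24 : ℂ := Complex.exp (2 * Real.pi * Complex.I / 24)

/-- The image of the basis (a,b) under an integer matrix. -/
def matBasis (P : Mat) (a b : ℂ) : ℂ × ℂ :=
  ((P 0 0 : ℂ) * a + (P 0 1 : ℂ) * b, (P 1 0 : ℂ) * a + (P 1 1 : ℂ) * b)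

/-- The image of the basis (a,b) under a rational matrix. -/
def matBasisQ (B : Matrix (Fin 2) (Fin 2) ℚ) (a b : ℂ) : ℂ × ℂ :=
  ((B 0 0 : ℂ) * a + (B 0 1 : ℂ) * b, (B 1 0 : ℂ) * a + (B 1 1 : ℂ) * b)

/-- φ_B for a rational matrix B of positive determinant. -/
def phiQ (B : Matrix (Fin 2) (Fin 2) ℚ) (z : ℂ) : ℂ :=
  (B.det : ℂ) ^ 12 *
      discC (((B 0 0 : ℂ) * z + (B 0 1 : ℂ)) / ((B 1 0 : ℂ) * z + (B 1 1 : ℂ))) /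
    (((B 1 0 : ℂ) * z + (B 1 1 : ℂ)) ^ 12 * discC z)

/-- The lattice attached to the complex conjugate of an ideal of the maximal order. -/
def conjIdealLat (K : Subfield ℂ) (I : Ideal ↥(OK K)) : AddSubgroup ℂ :=
  AddSubgroup.closure {z : ℂ | ∃ x ∈ I, (starRingEnd ℂ) (x : ℂ) = z}

/-- The triangular representatives (a b; 0 d), a·d = s, gcd(a,b,d) = 1, 0 ≤ b < d,
encoded as triples (a, b, d). -/
def triReps (s : ℕ) : Finset (ℕ × ℕ × ℕ) :=
  (Finset.range (s + 1) ×ˢ Finset.range (s + 1) ×ˢ Finset.range (s + 1)).filter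
    (fun t => 0 < t.1 ∧ 0 < t.2.2 ∧ t.1 * t.2.2 = s ∧
      Nat.gcd t.1 (Nat.gcd t.2.1 t.2.2) = 1 ∧ t.2.1 < t.2.2)

open Function UpperHalfPlane in
/-- Pairs of a function on `ℍ` and a power series in `exp (2πiτ/h)` converging to it. -/
def qExpansionSubring (h : ℝ) (_hh : 0 < h) : Subring ((ℍ → ℂ) × PowerSeries ℂ) where
  carrier := {x | ∀ τ : ℍ, HasSum (fun n => x.2.coeff n * Periodic.qParam h τ ^ n) (x.1 τ)}
  zero_mem' τ := by simp
  one_mem' τ := by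
    convert! hasSum_single (0 : ℕ) (f := fun n => (1 : PowerSeries ℂ).coeff n *
      Periodic.qParam h τ ^ n) (fun n hn => by simp [PowerSeries.coeff_one, hn])
    simp
  add_mem' hx hy τ := by simpa [add_mul] using (hx τ).add (hy τ)
  neg_mem' hx τ := by simpa using (hx τ).neg
  mul_mem' {x y} hx hy τ := by
    have key := (hx τ).summable.norm
    have key' := (hy τ).summable.norm
    have e : ∀ n : ℕ, ∑ kl ∈ Finset.HasAntidiagonal.antidiagonal n, (x.2.coeff kl.1 * Periodic.qParam h τ ^ kl.1) *
        (y.2.coeff kl.2 * Periodic.qParam h τ ^ kl.2) =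
        (x * y).2.coeff n * Periodic.qParam h τ ^ n := by
      intro n
      rw [Prod.snd_mul, PowerSeries.coeff_mul, Finset.sum_mul]
      refine Finset.sum_congr rfl fun kl hkl => ?_
      rw [← Finset.HasAntidiagonal.mem_antidiagonal.mp hkl]
      ring
    have hs := (summable_norm_sum_mul_antidiagonal_of_summable_norm key key').of_norm
    have ht := tsum_mul_tsum_eq_tsum_sum_antidiagonal_of_summable_norm key key'
    simp only [e] at hs ht
    rw [(hx τ).tsum_eq, (hy τ).tsum_eq] at ht
    rw [Prod.fst_mul, Pi.mul_apply, ht]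
    exact hs.hasSum

namespace qExpansionSubring

open Function UpperHalfPlane

variable {h : ℝ} {hh : 0 < h}

theorem mem_iff {f : ℍ → ℂ} {φ : PowerSeries ℂ} : (f, φ) ∈ qExpansionSubring h hh ↔
    ∀ τ : ℍ, HasSum (fun n => φ.coeff n * Periodic.qParam h τ ^ n) (f τ) := Iff.rfl

theorem const_mem (c : ℂ) : ((fun _ => c), PowerSeries.C c) ∈ qExpansionSubring h hh := by
  refine mem_iff.mpr fun τ => ?_
  convert hasSum_single (0 : ℕ) (f := fun n => (PowerSeries.C c).coeff n *
    Periodic.qParam h τ ^ n) (fun n hn => by simp [PowerSeries.coeff_C, hn])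
  simp

theorem qParam_mem :
    ((fun τ : ℍ => Periodic.qParam h τ), PowerSeries.X) ∈ qExpansionSubring h hh := by
  refine mem_iff.mpr fun τ => ?_
  convert hasSum_single (1 : ℕ) (f := fun n => (PowerSeries.X : PowerSeries ℂ).coeff n *
    Periodic.qParam h τ ^ n) (fun n hn => by simp [PowerSeries.coeff_X, hn])
  simp

theorem eq_zero_of_mem {φ : PowerSeries ℂ} (hφ : (0, φ) ∈ qExpansionSubring h hh) : φ = 0 := by
  have h0 : cuspFunction h 0 = 0 := by
    ext q
    rcases eq_or_ne q 0 with rfl | hq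
    · have := (tendsto_const_nhds (x := (0 : ℂ))
        (f := (nhdsWithin (0 : ℂ) {0}ᶜ))).limUnder_eq
      simpa [cuspFunction, Periodic.cuspFunction] using! this
    · simp [cuspFunction, Periodic.cuspFunction_eq_of_nonzero _ _ hq]
  have := hasFPowerSeriesOnBall_cuspFunction (c := fun n => φ.coeff n) hh
    (by rw [h0]; exact analyticAt_const) (mem_iff.mp hφ)
  rw [h0] at this
  ext n
  have h1 := congr_arg (FormalMultilinearSeries.coeff · n) this.hasFPowerSeriesAt.eq_zero
  have h2 : (0 : FormalMultilinearSeries ℂ ℂ ℂ).coeff n = 0 := rfl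
  simp only [FormalMultilinearSeries.coeff_ofScalars, h2] at h1
  simpa using h1

theorem snd_unique {f : ℍ → ℂ} {φ ψ : PowerSeries ℂ} (hφ : (f, φ) ∈ qExpansionSubring h hh)
    (hψ : (f, ψ) ∈ qExpansionSubring h hh) : φ = ψ := by
  have := (qExpansionSubring h hh).sub_mem hφ hψ
  rw [Prod.mk_sub_mk, sub_self] at this
  exact sub_eq_zero.mp (eq_zero_of_mem this)

theorem comp_mem {h' : ℝ} {hh' : 0 < h'} {f : ℍ → ℂ} {φ : PowerSeries ℂ}
    (hφ : (f, φ) ∈ qExpansionSubring h hh) {σ : ℍ → ℍ} {n : ℕ} (hn : n ≠ 0) {c : ℂ}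
    (hσ : ∀ τ, Periodic.qParam h (σ τ) = c * Periodic.qParam h' τ ^ n) :
    (f ∘ σ, PowerSeries.expand n hn (PowerSeries.rescale c φ)) ∈ qExpansionSubring h' hh' := by
  refine mem_iff.mpr fun τ => ?_
  rw [← (mul_right_injective₀ hn).hasSum_iff]
  · convert! mem_iff.mp hφ (σ τ) using 1
    ext k
    simp only [comp_apply, PowerSeries.coeff_expand_mul, PowerSeries.coeff_rescale, hσ]
    ring
  · intro m hm
    rw [PowerSeries.coeff_expand_of_not_dvd, zero_mul]
    rintro ⟨k, rfl⟩
    exact hm ⟨k, rfl⟩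

end qExpansionSubring

section KleinInvariant

open UpperHalfPlane ModularForm EisensteinSeries Function

theorem tsum_eq_riemannZeta_mul_E {k : ℕ} (hk : 3 ≤ k) (z : ℍ) :
    ∑' w : {v : ℤ × ℤ // v ≠ 0}, ((w.1.1 : ℂ) * z + (w.1.2 : ℂ)) ^ (-k : ℤ) =
      2 * riemannZeta k * E hk z := by
  have h1 := tsum_eisSummand_eq_riemannZeta_mul_eisensteinSeries hk z
  have hE : E hk z = (1 / 2 : ℂ) * eisensteinSeries (N := 1) 0 k z := rfl
  rw [hE]
  rw [← (finTwoArrowEquiv ℤ).symm.tsum_eq] at h1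
  have h2 := tsum_subtype_eq_of_support_subset
    (f := fun v : ℤ × ℤ => ((v.1 : ℂ) * z + (v.2 : ℂ)) ^ (-k : ℤ)) (s := {v | v ≠ 0}) (by
      intro v hv hv0
      subst hv0
      apply hv
      simp [zero_zpow _ (show (-k : ℤ) ≠ 0 by lia)])
  refine h2.trans ?_
  simp only [finTwoArrowEquiv_symm_apply, eisSummand, Matrix.cons_val_zero, Matrix.cons_val_one] at h1
  rw [h1]
  ring

theorem riemannZeta_six : riemannZeta 6 = (Real.pi : ℂ) ^ 6 / 945 := by
  have := riemannZeta_two_mul_nat (k := 3) (by norm_num)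
  norm_num [show _root_.bernoulli 6 = 1 / 42 by decide +kernel, Nat.factorial] at this
  rw [this]
  ring

theorem g2C_eq (z : ℍ) : g2C z = 4 * (Real.pi : ℂ) ^ 4 / 3 * E₄ z := by
  have := tsum_eq_riemannZeta_mul_E (k := 4) (by norm_num) z
  norm_num only [Nat.cast_ofNat] at this
  rw [g2C, this, riemannZeta_four]
  ring

theorem g3C_eq (z : ℍ) : g3C z = 8 * (Real.pi : ℂ) ^ 6 / 27 * E₆ z := by
  have := tsum_eq_riemannZeta_mul_E (k := 6) (by norm_num) z
  norm_num only [Nat.cast_ofNat] at this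
  rw [g3C, this, riemannZeta_six]
  ring

theorem jC_eq (z : ℍ) : jC z = E₄ z ^ 3 / discriminant z := by
  have hΔ := discriminant_eq_E₄_cube_sub_E₆_sq z
  have hpi : (Real.pi : ℂ) ≠ 0 := by exact_mod_cast Real.pi_ne_zero
  have hd : discC z = (2 * Real.pi : ℂ) ^ 12 * discriminant z := by
    rw [discC, g2C_eq, g3C_eq, hΔ]
    ring
  have := discriminant_ne_zero z
  rw [jC, hd, g2C_eq]
  field_simp
  ring

end KleinInvariant

section KleinInvariantQExpansion

open UpperHalfPlane ModularForm EisensteinSeries Function ArithmeticFunction Asymptotics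

theorem PowerSeries.coeff_ofNat_mul {R : Type*} [Semiring R] (k n : ℕ) [k.AtLeastTwo] (φ : PowerSeries R) :
    PowerSeries.coeff n ((ofNat(k) : PowerSeries R) * φ) =
      (OfNat.ofNat k : R) * PowerSeries.coeff n φ := by
  rw [← PowerSeries.coeff_C_mul, map_ofNat]

/-- The generating series `∑ σ_k(n) X ^ n`. -/
def sigmaSeries (k : ℕ) : PowerSeries ℤ := PowerSeries.mk fun n => (ArithmeticFunction.sigma k n : ℤ)

theorem E₄_mem_qExpansionSubring :
    (⇑E₄, PowerSeries.map (Int.castRingHom ℂ) (1 + 240 * sigmaSeries 3)) ∈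
      qExpansionSubring 1 one_pos := by
  have h := hasSum_qExpansion (f := ⇑E₄) one_pos
    (SlashInvariantFormClass.periodic_comp_ofComplex E₄ (one_mem_strictPeriods_SL))
    (ModularFormClass.holo E₄) (ModularFormClass.bdd_at_infty E₄)
  convert! qExpansionSubring.mem_iff.mpr h using 2
  ext n
  rw [PowerSeries.coeff_map, E_qExpansion_coeff _ ⟨2, rfl⟩, show _root_.bernoulli 4 = -1 / 30 by decide +kernel]
  rcases eq_or_ne n 0 with rfl | hn
  · simp [sigmaSeries]
  · norm_num [sigmaSeries, PowerSeries.coeff_one, hn, PowerSeries.coeff_ofNat_mul]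

theorem E₆_mem_qExpansionSubring :
    (⇑E₆, PowerSeries.map (Int.castRingHom ℂ) (1 - 504 * sigmaSeries 5)) ∈
      qExpansionSubring 1 one_pos := by
  have h := hasSum_qExpansion (f := ⇑E₆) one_pos
    (SlashInvariantFormClass.periodic_comp_ofComplex E₆ (one_mem_strictPeriods_SL))
    (ModularFormClass.holo E₆) (ModularFormClass.bdd_at_infty E₆)
  convert! qExpansionSubring.mem_iff.mpr h using 2
  ext n
  rw [PowerSeries.coeff_map, E_qExpansion_coeff _ ⟨3, rfl⟩, show _root_.bernoulli 6 = 1 / 42 by decide +kernel]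
  rcases eq_or_ne n 0 with rfl | hn
  · simp [sigmaSeries]
  · norm_num [sigmaSeries, PowerSeries.coeff_one, hn, PowerSeries.coeff_ofNat_mul]

theorem twelve_dvd_sigma (n : ℕ) : (12 : ℤ) ∣ 5 * ArithmeticFunction.sigma 3 n + 7 * ArithmeticFunction.sigma 5 n := by
  simp only [sigma_apply, Nat.cast_sum, Finset.mul_sum, ← Finset.sum_add_distrib]
  refine Finset.dvd_sum fun d _ => ?_
  have key : ∀ x : ZMod 12, 5 * x ^ 3 + 7 * x ^ 5 = 0 := by decide
  refine (ZMod.intCast_zmod_eq_zero_iff_dvd _ 12).mp ?_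
  simpa using key d

theorem exists_discriminant_qExpansion : ∃ v : PowerSeries ℤ, v.constantCoeff = 1 ∧
    (discriminant, PowerSeries.map (Int.castRingHom ℂ) (PowerSeries.X * v)) ∈
      qExpansionSubring 1 one_pos := by
  choose d hd using twelve_dvd_sigma
  set A := sigmaSeries 3
  set B := sigmaSeries 5
  have hD : 5 * A + 7 * B = 12 * PowerSeries.mk d := by
    ext n
    simpa [A, B, sigmaSeries, PowerSeries.coeff_ofNat_mul] using hd n
  have hd0 : d 0 = 0 := by simpa using hd 0
  have hd1 : d 1 = 1 := by have := hd 1; norm_num at this; lia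
  set δ := PowerSeries.mk d + 100 * A ^ 2 + 8000 * A ^ 3 - 147 * B ^ 2 with hδdef
  have hA : PowerSeries.X ∣ A := PowerSeries.X_dvd_iff.mpr (by simp [A, sigmaSeries])
  have hB : PowerSeries.X ∣ B := PowerSeries.X_dvd_iff.mpr (by simp [B, sigmaSeries])
  have hδ : 1728 * δ = (1 + 240 * A) ^ 3 - (1 - 504 * B) ^ 2 := by
    linear_combination (-144) * hD
  obtain ⟨A', hA'⟩ := hA
  obtain ⟨B', hB'⟩ := hB
  have hdX : PowerSeries.mk d = PowerSeries.X * PowerSeries.mk fun n => d (n + 1) := by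
    ext n
    cases n <;> simp [hd0, PowerSeries.coeff_succ_X_mul]
  refine ⟨(PowerSeries.mk fun n => d (n + 1)) + PowerSeries.X *
    (100 * A' ^ 2 + 8000 * PowerSeries.X * A' ^ 3 - 147 * B' ^ 2), by simp [hd1], ?_⟩
  have e : PowerSeries.X * ((PowerSeries.mk fun n => d (n + 1)) + PowerSeries.X *
    (100 * A' ^ 2 + 8000 * PowerSeries.X * A' ^ 3 - 147 * B' ^ 2)) = δ := by
    rw [hδdef, hA', hB', hdX]
    ring
  rw [e]
  have h1 := sub_mem (pow_mem E₄_mem_qExpansionSubring 3) (pow_mem E₆_mem_qExpansionSubring 2)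
  have h2 := mul_mem (qExpansionSubring.const_mem (h := 1) (hh := one_pos) (1 / 1728)) h1
  convert h2 using 1
  refine Prod.ext ?_ ?_
  · ext z
    simp [discriminant_eq_E₄_cube_sub_E₆_sq z]
    ring
  · rw [Prod.snd_mul, Prod.snd_sub, Prod.pow_snd, Prod.pow_snd, ← map_pow, ← map_pow, ← map_sub,
      ← hδ, map_mul, ← mul_assoc, map_ofNat,
      show (1728 : PowerSeries ℂ) = PowerSeries.C 1728 from (map_ofNat _ 1728).symm, ← map_mul]
    norm_num

theorem inv_discriminant_mem_qExpansionSubring : ∃ w : PowerSeries ℂ,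
    ((fun z : ℍ => Periodic.qParam 1 z / discriminant z), w) ∈ qExpansionSubring 1 one_pos := by
  refine ⟨_, qExpansionSubring.mem_iff.mpr (hasSum_qExpansion one_pos ?_ ?_ ?_)⟩
  · have h1 := SlashInvariantFormClass.periodic_comp_ofComplex CuspForm.discriminant
      (one_mem_strictPeriods_SL)
    intro w
    have h2 := h1 w
    have h3 : ∀ z : ℂ, ((fun z : ℍ => Periodic.qParam 1 z / discriminant z) ∘ ofComplex) z =
      Periodic.qParam 1 (ofComplex z) / (CuspForm.discriminant ∘ ofComplex) z := fun z => rfl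
    rw [h3, h3, h2]
    congr 1
    by_cases hw : 0 < w.im
    · rw [ofComplex_apply_of_im_pos hw, ofComplex_apply_of_im_pos (by simpa using hw)]
      simp [Periodic.qParam, mul_add, Complex.exp_add]
    · rw [ofComplex_apply_of_im_nonpos (not_lt.mp hw),
        ofComplex_apply_of_im_nonpos (by simpa using hw)]
  · rw [UpperHalfPlane.mdifferentiable_iff]
    have h1 := UpperHalfPlane.mdifferentiable_iff.mp CuspForm.discriminant.holo'
    have h2 : DifferentiableOn ℂ (fun z => Periodic.qParam 1 z) {z | 0 < z.im} :=
      (Periodic.differentiable_qParam).differentiableOn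
    refine (h2.div h1 fun z _ => discriminant_ne_zero _).congr fun z hz => ?_
    simp only [comp_apply, Pi.div_apply]
    rw [ofComplex_apply_of_im_pos hz]
    rfl
  · have h1 := exp_isBigO_discriminant
    have h2 : (fun τ : ℍ => Periodic.qParam 1 τ) =O[atImInfty]
        fun τ : ℍ => Real.exp (-2 * Real.pi * τ.im) :=
      Asymptotics.IsBigO.of_norm_le fun τ => by simp [Periodic.qParam, Complex.norm_exp]
    have h3 := (h2.trans h1).mul (Asymptotics.isBigO_refl (fun τ => (discriminant τ)⁻¹) atImInfty)
    simp only [← div_eq_mul_inv, div_self (discriminant_ne_zero _)] at h3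
    exact h3.trans (Asymptotics.isBigO_const_const _ one_ne_zero _)

/-- The product `q·j` has a `q`-expansion with integer coefficients and constant term `1`. -/
theorem exists_qParam_mul_jC_qExpansion : ∃ u : PowerSeries ℤ, u.constantCoeff = 1 ∧
    ((fun z : ℍ => Periodic.qParam 1 z * jC z), PowerSeries.map (Int.castRingHom ℂ) u) ∈
      qExpansionSubring 1 one_pos := by
  obtain ⟨v, hv, hΔ⟩ := exists_discriminant_qExpansion
  obtain ⟨w, hw⟩ := inv_discriminant_mem_qExpansionSubring
  obtain ⟨v', hv'⟩ : ∃ v', v * v' = 1 :=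
    (PowerSeries.isUnit_iff_constantCoeff.mpr (by simp [hv])).exists_right_inv
  have hvw : PowerSeries.map (Int.castRingHom ℂ) v * w = 1 := by
    have h := mul_mem hΔ hw
    have : ((discriminant * fun z : ℍ => Periodic.qParam 1 z / discriminant z)) =
        fun z : ℍ => Periodic.qParam 1 z := by
      ext z
      exact mul_div_cancel₀ _ (discriminant_ne_zero z)
    rw [Prod.mk_mul_mk, this, map_mul, PowerSeries.map_X, mul_assoc] at h
    have := qExpansionSubring.snd_unique h qExpansionSubring.qParam_mem
    exact mul_left_cancel₀ PowerSeries.X_ne_zero (this.trans (mul_one _).symm)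
  have hw' : w = PowerSeries.map (Int.castRingHom ℂ) v' := by
    have := congr_arg (PowerSeries.map (Int.castRingHom ℂ)) hv'
    rw [map_mul, map_one] at this
    rw [← mul_one w, ← this, mul_left_comm, ← mul_assoc, hvw, one_mul]
  subst hw'
  refine ⟨(1 + 240 * sigmaSeries 3) ^ 3 * v', ?_, ?_⟩
  · have := congr_arg PowerSeries.constantCoeff hv'
    rw [map_mul, hv, one_mul, map_one] at this
    simp [this, sigmaSeries]
  · convert mul_mem (pow_mem E₄_mem_qExpansionSubring 3) hw using 1
    refine Prod.ext ?_ (by simp)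
    ext z
    simp [jC_eq]
    ring

end KleinInvariantQExpansion

section OrbitRepresentatives

/-- The representatives `(1 ν; 0 p)` for `ν < p`, and `(p 0; 0 1)` for `ν = p`. -/
def primeReps (p : ℕ) (ν : ℕ) : Mat := if ν < p then !![1, ν; 0, p] else !![p, 0; 0, 1]

theorem primeReps_of_lt {p ν : ℕ} (h : ν < p) : primeReps p ν = !![1, (ν : ℤ); 0, p] := if_pos h

theorem primeReps_self (p : ℕ) : primeReps p p = !![(p : ℤ), 0; 0, 1] := if_neg (lt_irrefl p)

theorem leftEquiv_primeReps_self_iff {p : ℕ} (hp : p.Prime) {T : Mat} (hT : T.det = p) :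
    LeftEquiv T (primeReps p p) ↔ (p : ℤ) ∣ T 0 0 ∧ (p : ℤ) ∣ T 1 0 := by
  have hp0 : (p : ℤ) ≠ 0 := by exact_mod_cast hp.ne_zero
  rw [primeReps_self]
  constructor
  · rintro ⟨M, rfl⟩
    simp [Matrix.mul_apply, Fin.sum_univ_two]
  · rintro ⟨⟨a, ha⟩, c, hc⟩
    refine ⟨⟨!![a, T 0 1; c, T 1 1], ?_⟩, ?_⟩
    · rw [Matrix.det_fin_two, ha, hc] at hT
      rw [Matrix.det_fin_two_of]
      apply mul_left_cancel₀ hp0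
      linear_combination hT
    · ext i j
      fin_cases i <;> fin_cases j <;> simp [Matrix.mul_apply, Fin.sum_univ_two, ha, hc, mul_comm]

theorem leftEquiv_primeReps_iff {p : ℕ} (hp : p.Prime) {T : Mat} (hT : T.det = p) {ν : ℕ}
    (hν : ν < p) : LeftEquiv T (primeReps p ν) ↔
      (p : ℤ) ∣ T 0 1 - ν * T 0 0 ∧ (p : ℤ) ∣ T 1 1 - ν * T 1 0 := by
  have hp0 : (p : ℤ) ≠ 0 := by exact_mod_cast hp.ne_zero
  rw [primeReps_of_lt hν]
  constructor
  · rintro ⟨M, rfl⟩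
    constructor
    · exact ⟨M 0 1, by simp [Matrix.mul_apply, Fin.sum_univ_two]; ring⟩
    · exact ⟨M 1 1, by simp [Matrix.mul_apply, Fin.sum_univ_two]; ring⟩
  · rintro ⟨⟨b, hb⟩, d, hd⟩
    refine ⟨⟨!![T 0 0, b; T 1 0, d], ?_⟩, ?_⟩
    · rw [Matrix.det_fin_two] at hT
      rw [Matrix.det_fin_two_of]
      apply mul_left_cancel₀ hp0
      linear_combination hT + T 1 0 * hb - T 0 0 * hd
    · ext i j
      fin_cases i <;> fin_cases j <;> simp [Matrix.mul_apply, Fin.sum_univ_two] <;>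
        first | linear_combination hb | linear_combination hd

theorem existsUnique_leftEquiv_primeReps {p : ℕ} (hp : p.Prime) {T : Mat} (hT : T.det = p) :
    ∃! ν, ν < p + 1 ∧ LeftEquiv T (primeReps p ν) := by
  have hp0 : (p : ℤ) ≠ 0 := by exact_mod_cast hp.ne_zero
  have hpp : Prime (p : ℤ) := Nat.prime_iff_prime_int.mp hp
  have hdet := hT
  rw [Matrix.det_fin_two] at hdet
  by_cases h : (p : ℤ) ∣ T 0 0 ∧ (p : ℤ) ∣ T 1 0
  · refine ⟨p, ⟨p.lt_succ_self, (leftEquiv_primeReps_self_iff hp hT).mpr h⟩, ?_⟩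
    rintro ν ⟨hν, hν'⟩
    by_contra hne
    rw [leftEquiv_primeReps_iff hp hT (by lia)] at hν'
    have hb := (dvd_add_left (h.1.mul_left (ν : ℤ))).mpr hν'.1
    have hd := (dvd_add_left (h.2.mul_left (ν : ℤ))).mpr hν'.2
    rw [sub_add_cancel] at hb hd
    obtain ⟨⟨⟨a, ha⟩, c, hc⟩, ⟨b, hb⟩, d, hd⟩ := h, hb, hd
    rw [ha, hb, hc, hd] at hdet
    refine hpp.not_isUnit (IsUnit.of_mul_eq_one (a * d - b * c) (mul_left_cancel₀ hp0 ?_))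
    linear_combination hdet
  · have hu : ∀ ν < p, LeftEquiv T (primeReps p ν) → ∀ μ < p, LeftEquiv T (primeReps p μ) →
        μ = ν := by
      intro ν hν h1 μ hμ h2
      rw [leftEquiv_primeReps_iff hp hT ‹_›] at h1 h2
      have ha : (p : ℤ) ∣ (μ - ν) * T 0 0 := by
        exact (dvd_sub h1.1 h2.1).trans (dvd_of_eq (by ring))
      have hc : (p : ℤ) ∣ (μ - ν) * T 1 0 := by
        exact (dvd_sub h1.2 h2.2).trans (dvd_of_eq (by ring))
      have hd : (p : ℤ) ∣ μ - ν := by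
        by_contra hd
        exact h ⟨(hpp.dvd_mul.mp ha).resolve_left hd, (hpp.dvd_mul.mp hc).resolve_left hd⟩
      have := Int.eq_zero_of_abs_lt_dvd hd (by rw [abs_lt]; constructor <;> lia)
      lia
    have he : ∃ ν < p, LeftEquiv T (primeReps p ν) := by
      suffices ∃ n : ℤ, (p : ℤ) ∣ T 0 1 - n * T 0 0 ∧ (p : ℤ) ∣ T 1 1 - n * T 1 0 by
        obtain ⟨n, h0, h1⟩ := this
        have hn : ((n % p).toNat : ℤ) = n - p * (n / p) := by
          rw [Int.toNat_of_nonneg (Int.emod_nonneg _ hp0), Int.emod_def]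
        refine ⟨(n % p).toNat, ?_, (leftEquiv_primeReps_iff hp hT ?_).mpr ⟨?_, ?_⟩⟩
        · zify; rw [Int.toNat_of_nonneg (Int.emod_nonneg _ hp0)]
          exact Int.emod_lt_of_pos _ (by exact_mod_cast hp.pos)
        · zify; rw [Int.toNat_of_nonneg (Int.emod_nonneg _ hp0)]
          exact Int.emod_lt_of_pos _ (by exact_mod_cast hp.pos)
        · rw [hn]
          exact (dvd_add h0 (dvd_mul_right (p : ℤ) (n / p * T 0 0))).trans (dvd_of_eq (by ring))
        · rw [hn]
          exact (dvd_add h1 (dvd_mul_right (p : ℤ) (n / p * T 1 0))).trans (dvd_of_eq (by ring))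
      rw [not_and_or] at h
      rcases h with h | h
      · obtain ⟨x, y, hxy⟩ := (hpp.coprime_iff_not_dvd.mpr h)
        refine ⟨y * T 0 1, ⟨x * T 0 1, ?_⟩, ⟨x * T 1 1 + y, ?_⟩⟩
        · linear_combination -T 0 1 * hxy
        · linear_combination -T 1 1 * hxy + y * hdet
      · obtain ⟨x, y, hxy⟩ := (hpp.coprime_iff_not_dvd.mpr h)
        refine ⟨y * T 1 1, ⟨x * T 0 1 - y, ?_⟩, ⟨x * T 1 1, ?_⟩⟩
        · linear_combination -T 0 1 * hxy - y * hdet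
        · linear_combination -T 1 1 * hxy
    obtain ⟨ν, hν, hν'⟩ := he
    refine ⟨ν, ⟨by lia, hν'⟩, ?_⟩
    rintro μ ⟨hμ, hμ'⟩
    rcases (Nat.lt_succ_iff_lt_or_eq.mp hμ) with hlt | rfl
    · exact hu ν hν hν' μ hlt hμ'
    · exact absurd ((leftEquiv_primeReps_self_iff hp hT).mp hμ') h

theorem isOrbitReps_primeReps {p n : ℕ} (hp : p.Prime) (hn : n = p + 1) :
    IsOrbitReps p (fun ν : Fin n => primeReps p ν) := by
  subst hn
  refine ⟨fun ν => show (primeReps p ν).IsPrimitive ∧ (primeReps p ν).det = p from ?_, fun T _ hT => ?_⟩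
  · rcases Nat.lt_succ_iff_lt_or_eq.mp ν.2 with h | h
    · rw [primeReps_of_lt h]
      simp [Mat.IsPrimitive, Matrix.det_fin_two]
    · rw [h, primeReps_self]
      simp [Mat.IsPrimitive, Matrix.det_fin_two]
  · obtain ⟨ν, ⟨h1, h2⟩, h3⟩ := existsUnique_leftEquiv_primeReps hp hT
    exact ⟨⟨ν, h1⟩, h2, fun μ hμ => Fin.ext (h3 μ ⟨μ.2, hμ⟩)⟩

theorem psi_prime {p : ℕ} (hp : p.Prime) : psi p = p + 1 := by
  rw [psi, hp.sum_divisors]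
  simp [hp.prime.squarefree, Nat.div_self hp.pos, add_comm]

end OrbitRepresentatives

section Homogenization

/-- The homogenization of `F`, evaluated at `(x, y)`. -/
def homogEval {A : Type*} [CommRing A] (F : ℤ[X]) (x y : A) : A :=
  ∑ k ∈ Finset.range (F.natDegree + 1), (F.coeff k : A) * x ^ k * y ^ (F.natDegree - k)

theorem map_homogEval {A B : Type*} [CommRing A] [CommRing B] (f : A →+* B) (F : ℤ[X]) (x y : A) :
    f (homogEval F x y) = homogEval F (f x) (f y) := by
  simp [homogEval]

theorem homogEval_mul_self {A : Type*} [CommRing A] (F : ℤ[X]) (x y : A) :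
    homogEval F (x * y) y = y ^ F.natDegree * eval₂ (Int.castRingHom A) x F := by
  rw [homogEval, eval₂_eq_sum_range, Finset.mul_sum]
  refine Finset.sum_congr rfl fun k hk => ?_
  rw [← pow_sub_mul_pow y (Finset.mem_range_succ_iff.mp hk), eq_intCast]
  ring

/-- Expansion of `X ^ (2p²) * (X ^ p) ^ deg F * F(j)`, for the series `X ^ (-p) * u(X ^ p)` of `j`
in the variable `X = exp (2πiτ/p)`. -/
def diagSeries {A : Type*} [CommRing A] (F : ℤ[X]) (u : PowerSeries ℤ) {p : ℕ} (hp : p ≠ 0) :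
    PowerSeries A :=
  PowerSeries.X ^ (2 * p ^ 2) *
    homogEval F (PowerSeries.expand p hp (u.map (Int.castRingHom A))) (PowerSeries.X ^ p)

/-- Expansion of `X ^ (2p²) * (X ^ p) ^ N * ∏ (j - j ∘ S)`, with `S` running through
the representatives `(1 ν; 0 p)` and `(p 0; 0 1)`. -/
def conjSeries {A : Type*} [CommRing A] (N : ℕ) (u : PowerSeries ℤ) {p : ℕ} (hp : p ≠ 0) (ζ : A) :
    PowerSeries A :=
  (PowerSeries.X ^ p) ^ N * (PowerSeries.X ^ (p * (p - 1)) *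
      PowerSeries.expand p hp (u.map (Int.castRingHom A)) -
        PowerSeries.expand p hp (PowerSeries.expand p hp (u.map (Int.castRingHom A)))) *
    ∏ i ∈ Finset.range p, (PowerSeries.expand p hp (u.map (Int.castRingHom A)) -
      PowerSeries.X ^ (p - 1) * (PowerSeries.C (ζ ^ (i * (p - 1))) *
        PowerSeries.rescale (ζ ^ i) (u.map (Int.castRingHom A))))

variable {A B : Type*} [CommRing A] [CommRing B] (f : A →+* B)

theorem map_map_intCastRingHom (u : PowerSeries ℤ) :
    (u.map (Int.castRingHom A)).map f = u.map (Int.castRingHom B) := by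
  ext n
  simp

theorem map_diagSeries (F : ℤ[X]) (u : PowerSeries ℤ) {p : ℕ} (hp : p ≠ 0) :
    PowerSeries.map f (diagSeries F u hp) = diagSeries F u hp := by
  simp [diagSeries, map_homogEval, map_map_intCastRingHom]

theorem map_conjSeries (N : ℕ) (u : PowerSeries ℤ) {p : ℕ} (hp : p ≠ 0) (ζ : A) :
    PowerSeries.map f (conjSeries N u hp ζ) = conjSeries N u hp (f ζ) := by
  have h : ∀ a : A, PowerSeries.map f (PowerSeries.rescale a (u.map (Int.castRingHom A))) =
      PowerSeries.rescale (f a) (u.map (Int.castRingHom B)) := fun a => by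
    ext n
    simp [PowerSeries.coeff_rescale]
  simp [conjSeries, map_map_intCastRingHom, map_prod, h]

end Homogenization

section DiagonalIdentity

open UpperHalfPlane Function

theorem eval₂_jC_diagPoly {p : ℕ} (hp : p.Prime) {J : ℤ[X][X]} (hJ : IsModularPoly p J) (τ : ℍ) :
    eval₂ (Int.castRingHom ℂ) (jC τ) (diagPoly J) = (jC τ - jC (p * τ)) *
      ∏ i ∈ Finset.range p, (jC τ - jC ((τ + i) / p)) := by
  have h := congr_arg (Polynomial.eval (jC τ)) (hJ.2.2 _ (isOrbitReps_primeReps hp (psi_prime hp)) τ τ.2)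
  have h1 : evalAtJ τ X = jC τ := by simp [evalAtJ]
  rw [eval_map, ← h1, eval₂_at_apply] at h
  have h2 : evalAtJ τ (diagPoly J) = eval₂ (Int.castRingHom ℂ) (jC τ) (diagPoly J) := rfl
  rw [← h2, diagPoly, h, h1, eval_prod]
  simp only [eval_sub, eval_X, eval_C]
  rw [Finset.prod_range (fun ν => jC τ - jC (moeb (primeReps p ν) τ)) |>.symm, psi_prime hp,
    Finset.prod_range_succ, mul_comm]
  refine congr_arg₂ (· * ·) ?_ (Finset.prod_congr rfl fun i hi => ?_)
  · simp [primeReps_self, moeb]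
  · simp [primeReps_of_lt (Finset.mem_range.mp hi), moeb]

theorem qParam_one_eq_pow {p : ℕ} (hp : p ≠ 0) (z : ℂ) :
    Periodic.qParam 1 z = Periodic.qParam p z ^ p := by
  have : (p : ℂ) ≠ 0 := by exact_mod_cast hp
  rw [Periodic.qParam, Periodic.qParam, ← Complex.exp_nat_mul]
  congr 1
  push_cast
  field_simp

theorem qParam_one_nat_mul {p : ℕ} (hp : p ≠ 0) (z : ℂ) :
    Periodic.qParam 1 (p * z) = Periodic.qParam p z ^ (p * p) := by
  have : (p : ℂ) ≠ 0 := by exact_mod_cast hp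
  rw [Periodic.qParam, Periodic.qParam, ← Complex.exp_nat_mul]
  congr 1
  push_cast
  field_simp

theorem qParam_one_add_div {p : ℕ} (hp : p ≠ 0) (i : ℕ) (z : ℂ) :
    Periodic.qParam 1 ((z + i) / p) =
      Complex.exp (2 * Real.pi * Complex.I / p) ^ i * Periodic.qParam p z := by
  have : (p : ℂ) ≠ 0 := by exact_mod_cast hp
  rw [Periodic.qParam, Periodic.qParam, ← Complex.exp_nat_mul, ← Complex.exp_add]
  congr 1
  push_cast
  field_simp
  ring

theorem pow_mul_prod_sub_eq {A : Type*} [CommRing A] {p : ℕ} (hp : 0 < p) (q x c : A) (b : ℕ → A) :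
    q ^ (2 * p ^ 2) * ((x - c) * ∏ i ∈ Finset.range p, (x - b i)) =
      (q ^ (p * (p - 1)) * (x * q ^ p) - q ^ (p * p) * c) *
        ∏ i ∈ Finset.range p, (x * q ^ p - q ^ (p - 1) * (q * b i)) := by
  obtain ⟨m, rfl⟩ := Nat.exists_eq_add_one.mpr hp
  have h : ∏ i ∈ Finset.range (m + 1), (x * q ^ (m + 1) - q ^ (m + 1 - 1) * (q * b i)) =
      (q ^ (m + 1)) ^ (m + 1) * ∏ i ∈ Finset.range (m + 1), (x - b i) := by
    rw [show (q ^ (m + 1)) ^ (m + 1) = ∏ _i ∈ Finset.range (m + 1), q ^ (m + 1) by simp, ← Finset.prod_mul_distrib]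
    refine Finset.prod_congr rfl fun i _ => ?_
    rw [Nat.add_sub_cancel]
    ring
  rw [h, Nat.add_sub_cancel]
  ring

/-- The `q`-expansions of `q·j` precomposed with the identity, `(p 0; 0 1)` and `(1 i; 0 p)`. -/
theorem exists_mem_qExpansionSubring_comp {p : ℕ} (hp : p ≠ 0) (hpR : (0 : ℝ) < p)
    {f : ℂ → ℂ} {U : PowerSeries ℂ}
    (hmem : ((fun z : ℍ => Periodic.qParam 1 z * f z), U) ∈ qExpansionSubring 1 one_pos) :
    ((fun τ : ℍ => f τ * Periodic.qParam p τ ^ p), PowerSeries.expand p hp U) ∈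
        qExpansionSubring p hpR ∧
      ((fun τ : ℍ => Periodic.qParam p τ ^ (p * p) * f (p * τ)),
        PowerSeries.expand p hp (PowerSeries.expand p hp U)) ∈ qExpansionSubring p hpR ∧
      ∀ i : ℕ, ((fun τ : ℍ => Complex.exp (2 * Real.pi * Complex.I / p) ^ i *
        Periodic.qParam p τ * f ((τ + i) / p)),
          PowerSeries.rescale (Complex.exp (2 * Real.pi * Complex.I / p) ^ i) U) ∈
            qExpansionSubring p hpR := by
  refine ⟨?_, ?_, fun i => ?_⟩
  · convert! qExpansionSubring.comp_mem (h' := p) (hh' := hpR) hmem (σ := id) (c := 1) hp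
      (fun τ => by rw [one_mul]; exact qParam_one_eq_pow hp τ) using 2
    · ext τ
      simp [qParam_one_eq_pow hp, mul_comm]
    · simp
  · have him (τ : ℍ) : 0 < ((p : ℂ) * τ).im := by simpa using mul_pos hpR τ.2
    convert! qExpansionSubring.comp_mem (h' := p) (hh' := hpR) hmem (σ := fun τ => ⟨p * τ, him τ⟩)
      (c := 1) (mul_ne_zero hp hp) (fun τ => by rw [one_mul]; exact qParam_one_nat_mul hp τ) using 2
    · ext τ
      simp [qParam_one_nat_mul hp]
    · simp [PowerSeries.expand_mul p hp p hp]
  · have him (τ : ℍ) : 0 < ((τ + i : ℂ) / p).im := by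
      rw [show (p : ℂ) = (p : ℝ) by simp, Complex.div_ofReal_im]
      simpa using div_pos τ.2 hpR
    convert! qExpansionSubring.comp_mem (h' := p) (hh' := hpR) hmem
      (σ := fun τ => ⟨(τ + i) / p, him τ⟩) (c := _) one_ne_zero
      (fun τ => by rw [pow_one]; exact qParam_one_add_div hp i τ) using 2
    · ext τ
      simp [qParam_one_add_div hp]
    · simp

theorem exists_diagSeries_eq_conjSeries {p : ℕ} (hp : p.Prime) {J : ℤ[X][X]}
    (hJ : IsModularPoly p J) : ∃ u : PowerSeries ℤ, u.constantCoeff = 1 ∧ ∃ ζ : ℂ, ζ ^ p = 1 ∧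
      diagSeries (diagPoly J) u hp.ne_zero = conjSeries (diagPoly J).natDegree u hp.ne_zero ζ := by
  obtain ⟨u, hu, hmem⟩ := exists_qParam_mul_jC_qExpansion
  have hpR : (0 : ℝ) < p := by exact_mod_cast hp.pos
  obtain ⟨ha, hc, hb⟩ := exists_mem_qExpansionSubring_comp hp.ne_zero hpR hmem
  set ζ : ℂ := Complex.exp (2 * Real.pi * Complex.I / p) with hζ
  have hζp : ζ ^ p = 1 := by
    rw [hζ, ← Complex.exp_nat_mul, mul_div_cancel₀ _ (by exact_mod_cast hp.ne_zero),
      Complex.exp_two_pi_mul_I]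
  refine ⟨u, hu, ζ, hζp, ?_⟩
  have hlift : ∀ {x}, x ∈ qExpansionSubring p hpR → ∃ s : qExpansionSubring p hpR, s.1 = x :=
    fun {x} hx => ⟨⟨x, hx⟩, rfl⟩
  obtain ⟨t, ht⟩ := hlift qExpansionSubring.qParam_mem
  obtain ⟨a, ha⟩ := hlift ha
  obtain ⟨c, hc⟩ := hlift hc
  choose b hb using fun i => hlift (hb i)
  choose z hz using fun i : ℕ => hlift (qExpansionSubring.const_mem (ζ ^ (i * (p - 1))))
  obtain ⟨L, hL⟩ : ∃ L, L = t ^ (2 * p ^ 2) * homogEval (diagPoly J) a (t ^ p) := ⟨_, rfl⟩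
  obtain ⟨R, hR⟩ : ∃ R, R = (t ^ p) ^ (diagPoly J).natDegree * (t ^ (p * (p - 1)) * a - c) *
    ∏ i ∈ Finset.range p, (a - t ^ (p - 1) * (z i * b i)) := ⟨_, rfl⟩
  have key : L.1.1 = R.1.1 := by
    ext τ
    let f : qExpansionSubring p hpR →+* ℂ :=
      (Pi.evalRingHom (fun _ => ℂ) τ).comp ((RingHom.fst (ℍ → ℂ) (PowerSeries ℂ)).comp
        (Subring.subtype _))
    change f L = f R
    have hf : ∀ s, f s = s.1.1 τ := fun _ => rfl
    have hzb : ∀ i, f (z i) * f (b i) = Periodic.qParam p τ * jC ((τ + i) / p) := fun i => by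
      have : ζ ^ (i * (p - 1)) * ζ ^ i = 1 := by
        rw [← pow_add, ← Nat.mul_succ, Nat.succ_eq_add_one, Nat.sub_add_cancel hp.one_le, mul_comm,
          pow_mul, hζp, one_pow]
      rw [hf, hf, hz, hb]
      linear_combination (Periodic.qParam p τ * jC ((τ + i) / p)) * this
    rw [hL, hR]
    simp only [map_mul, map_pow, map_sub, map_prod, map_homogEval, hzb]
    rw [hf, hf, hf, ha, hc, ht, homogEval_mul_self, eval₂_jC_diagPoly hp hJ, mul_assoc (_ ^ _),
      ← pow_mul_prod_sub_eq hp.pos]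
    ring
  have key' : L.1.2 = R.1.2 :=
    qExpansionSubring.snd_unique (f := L.1.1) (hh := hpR) L.2 (key ▸ R.2)
  let g : qExpansionSubring p hpR →+* PowerSeries ℂ := (RingHom.snd _ _).comp (Subring.subtype _)
  have hg : ∀ s, g s = s.1.2 := fun _ => rfl
  rw [← hg, ← hg, hL, hR] at key'
  simp only [map_mul, map_pow, map_sub, map_prod, map_homogEval] at key'
  simpa only [diagSeries, conjSeries, hg, ht, ha, hc, hb, hz] using key'

end DiagonalIdentity

section ReductionModPrime

theorem pow_char_eq_expand {k : Type*} [Field k] (p : ℕ) [Fact p.Prime] [CharP k p] (hp : p ≠ 0)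
    (u : PowerSeries ℤ) : (u.map (Int.castRingHom k)) ^ p =
      PowerSeries.expand p hp (u.map (Int.castRingHom k)) := by
  refine (MvPowerSeries.map_frobenius_expand p hp (f := u.map (Int.castRingHom k))).symm.trans ?_
  change PowerSeries.map (frobenius k p) (PowerSeries.expand p hp _) = _
  rw [PowerSeries.map_expand, map_map_intCastRingHom]

theorem conjSeries_one {k : Type*} [Field k] {p : ℕ} [Fact p.Prime] [CharP k p] (hp : p ≠ 0)
    (N : ℕ) (u : PowerSeries ℤ) : conjSeries N u hp (1 : k) =
      -((PowerSeries.X ^ p) ^ N * (PowerSeries.expand p hp (u.map (Int.castRingHom k)) ^ p -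
        PowerSeries.X ^ (p * (p - 1)) *
          PowerSeries.expand p hp (u.map (Int.castRingHom k))) ^ 2) := by
  have hX : CharP (PowerSeries k) p := charP_of_injective_algebraMap
    (FaithfulSMul.algebraMap_injective k (PowerSeries k)) p
  set U := u.map (Int.castRingHom k) with hU
  have h1 : U ^ p = PowerSeries.expand p hp U := pow_char_eq_expand p hp u
  have h2 : PowerSeries.expand p hp U ^ p =
      PowerSeries.expand p hp (PowerSeries.expand p hp U) := by
    rw [← map_pow, h1]
  simp only [conjSeries, one_pow, map_one, one_mul, PowerSeries.rescale_one, RingHom.id_apply,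
    Finset.prod_const, Finset.card_range, ← hU]
  rw [sub_pow_char, mul_pow, h1, ← h2, ← pow_mul PowerSeries.X (p - 1) p, mul_comm (p - 1) p]
  ring

/-- The reduction of `diagPoly J` modulo a prime above `p`. -/
theorem map_diagPoly_eq {k : Type*} [Field k] {p : ℕ} [hp : Fact p.Prime] [CharP k p]
    {F : ℤ[X]} {u : PowerSeries ℤ} (hu : u.constantCoeff = 1)
    (h : diagSeries F u hp.out.ne_zero =
      conjSeries F.natDegree u hp.out.ne_zero (1 : k)) :
    (F + (X ^ p - X) ^ 2).map (Int.castRingHom k) = 0 := by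
  rw [conjSeries_one, diagSeries] at h
  set V := PowerSeries.expand p hp.out.ne_zero (u.map (Int.castRingHom k)) with hV
  let K := FractionRing (PowerSeries k)
  let f := algebraMap (PowerSeries k) K
  have hf : Function.Injective f := IsFractionRing.injective _ _
  have ht : f PowerSeries.X ≠ 0 := fun h0 =>
    PowerSeries.X_ne_zero (hf (h0.trans (map_zero f).symm))
  set t := f PowerSeries.X with htdef
  obtain ⟨x, hx⟩ : ∃ x, f V = x * t ^ p := ⟨f V / t ^ p, (div_mul_cancel₀ _ (pow_ne_zero _ ht)).symm⟩
  have h' := congr_arg f h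
  simp only [map_mul, map_pow, map_sub, map_neg, map_homogEval, hx, ← htdef,
    homogEval_mul_self] at h'
  have hFx : eval₂ (Int.castRingHom K) x (F + (X ^ p - X) ^ 2) = 0 := by
    simp only [eval₂_add, eval₂_pow, eval₂_sub, eval₂_X]
    have h0 : t ^ (2 * p ^ 2) * (t ^ p) ^ F.natDegree ≠ 0 :=
      mul_ne_zero (pow_ne_zero _ ht) (pow_ne_zero _ (pow_ne_zero _ ht))
    apply mul_left_cancel₀ h0
    obtain ⟨m, hm⟩ := Nat.exists_eq_add_one.mpr hp.out.pos
    rw [mul_zero]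
    rw [hm] at h' ⊢
    rw [Nat.add_sub_cancel] at h'
    linear_combination h'
  set G := F + (X ^ p - X) ^ 2
  by_contra hG
  have hint : IsIntegral k x := by
    refine IsAlgebraic.isIntegral ⟨_, hG, ?_⟩
    rw [aeval_def, eval₂_map, RingHom.eq_intCast' ((algebraMap k K).comp (Int.castRingHom k)), hFx]
  obtain ⟨y, hy⟩ := IsIntegrallyClosed.isIntegral_iff.mp (hint.tower_top (A := PowerSeries k))
  have hVy : V = y * PowerSeries.X ^ p := hf (by rw [hx, ← hy, map_mul, map_pow])
  have := congr_arg PowerSeries.constantCoeff hVy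
  rw [hV, PowerSeries.constantCoeff_expand, ← PowerSeries.coeff_zero_eq_constantCoeff,
    PowerSeries.coeff_map, PowerSeries.coeff_zero_eq_constantCoeff, hu] at this
  simp [hp.out.ne_zero] at this

theorem prime_dvd_coeff_diagPoly {p : ℕ} (hp : p.Prime) {F : ℤ[X]} {u : PowerSeries ℤ}
    (hu : u.constantCoeff = 1) {ζ : ℂ} (hζ : ζ ^ p = 1)
    (h : diagSeries F u hp.ne_zero = conjSeries F.natDegree u hp.ne_zero ζ) (k : ℕ) :
    (p : ℤ) ∣ (F + (X ^ p - X) ^ 2).coeff k := by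
  have := Fact.mk hp
  let R := integralClosure ℤ ℂ
  obtain ⟨ξ, rfl⟩ : ∃ ξ : R, algebraMap R ℂ ξ = ζ :=
    ⟨⟨ζ, IsIntegral.of_pow hp.pos (hζ ▸ isIntegral_one)⟩, rfl⟩
  have hinj : Function.Injective (algebraMap R ℂ) := Subtype.val_injective
  have hξ : ξ ^ p = 1 := hinj (by rw [map_pow, hζ, map_one])
  have hR : (diagSeries F u hp.ne_zero : PowerSeries R) =
      conjSeries F.natDegree u hp.ne_zero ξ :=
    PowerSeries.map_injective _ hinj (by rw [map_diagSeries, map_conjSeries, h])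
  have hpp : Prime (p : ℤ) := Nat.prime_iff_prime_int.mp hp
  have : (Ideal.span {(p : ℤ)}).IsMaximal :=
    PrincipalIdealRing.isMaximal_of_irreducible hpp.irreducible
  obtain ⟨m, hm, hmp⟩ := Ideal.exists_ideal_over_maximal_of_isIntegral (S := R)
    (Ideal.span {(p : ℤ)}) (by
      rw [(RingHom.injective_iff_ker_eq_bot _).mp (FaithfulSMul.algebraMap_injective ℤ R)]
      exact bot_le)
  let := Ideal.Quotient.field m
  have hker : ∀ n : ℤ, ((n : R ⧸ m) = 0 ↔ (p : ℤ) ∣ n) := fun n => by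
    rw [← Ideal.mem_span_singleton, ← hmp, Ideal.mem_comap, ← Ideal.Quotient.eq_zero_iff_mem]
    simp
  have : CharP (R ⧸ m) p := ⟨fun n => by
    have := hker n
    rwa [Int.cast_natCast, Int.natCast_dvd_natCast] at this⟩
  have h1 : Ideal.Quotient.mk m ξ = 1 := by
    have h2 : (Ideal.Quotient.mk m ξ) ^ p = 1 := by rw [← map_pow, hξ, map_one]
    have h3 : (Ideal.Quotient.mk m ξ - 1) ^ p = 0 := by rw [sub_pow_char, h2, one_pow, sub_self]
    exact sub_eq_zero.mp (eq_zero_of_pow_eq_zero h3)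
  have hk := congr_arg (PowerSeries.map (Ideal.Quotient.mk m)) hR
  rw [map_diagSeries, map_conjSeries, h1] at hk
  have := congr_arg (coeff · k) (map_diagPoly_eq hu hk)
  rw [coeff_map, coeff_zero] at this
  exact (hker _).mp this

end ReductionModPrime

/-- For a prime p, J_p(X,X) ≡ −(X^p − X)² mod p, coefficientwise;
in particular J_p(X,X) is not the zero polynomial. -/
theorem stmt4 (p : ℕ) (hp : p.Prime) (J : Polynomial (Polynomial ℤ))
    (hJ : IsModularPoly p J) :
    (∀ k : ℕ, (p : ℤ) ∣
      (diagPoly J + ((Polynomial.X : Polynomial ℤ) ^ p - Polynomial.X) ^ 2).coeff k) ∧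
    diagPoly J ≠ 0 := by
  obtain ⟨u, hu, ζ, hζ, h⟩ := exists_diagSeries_eq_conjSeries hp hJ
  have hdvd := prime_dvd_coeff_diagPoly hp hu hζ h
  refine ⟨hdvd, fun h0 => ?_⟩
  have := Fact.mk hp
  refine pow_ne_zero 2 (FiniteField.X_pow_card_sub_X_ne_zero (ZMod p) hp.one_lt) ?_
  ext k
  have hk := (ZMod.intCast_zmod_eq_zero_iff_dvd _ p).mpr (hdvd k)
  rw [h0, zero_add] at hk
  rw [coeff_zero, ← hk, ← eq_intCast (Int.castRingHom (ZMod p)), ← coeff_map]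
  simp

end
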